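/- arXiv:2106.07871 — 2 statements merged into one kernel-verified Lean document; each statement's English description precedes it below -/
import Mathlib

section
/- Let G = (V, E) be a loopless connected multigraph with V = {v_1, …, v_n} and let 𝕊 be the family of all subsets S of {(e_j, v_i) : i ∈ [n−1], e_j ∈ E_G(v_i)} containing exactly one pair (e_j, v_i) for each i ∈ [n−1]. For S ∈ 𝕊, let E(S) = {e_j : (e_j, v_i) ∈ S} and let ⟨G_{v_n}⟩_S denote the component containing v_n of the spanning subgraph with edge set E(S). Then 𝕊 is partitioned into the subfamily {S ∈ 𝕊 : E(S) = E(T) for some spanning tree T of G} and the disjoint union over all non-spanning subtrees T_0 of G containing v_n of the subfamilies {S ∈ 𝕊 : E(⟨G_{v_n}⟩_S) = E(T_0)}. -/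
/-- A loopless undirected multigraph with vertex type `V` and edge type `E`:
every edge `e` is assigned an unordered pair `G.inc e` of two *distinct*
endpoints (parallel edges are allowed since `E` is an abstract edge type). -/
structure Multigraph (V : Type) (E : Type) where
  inc : E → Sym2 V
  loopless : ∀ e : E, ¬ (inc e).IsDiag

namespace Multigraph

variable {V E : Type}

/-- The degree of a vertex `v` in `G`: the number of edges incident with `v`. -/
noncomputable def deg (G : Multigraph V E) (v : V) : ℕ :=
  {e : E | v ∈ G.inc e}.ncard

/-- Adjacency using only edges from the edge set `F`. -/
def AdjOn (G : Multigraph V E) (F : Set E) (a b : V) : Prop :=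
  ∃ e ∈ F, G.inc e = s(a, b)

/-- Reachability using only edges from the edge set `F`. -/
def Reach (G : Multigraph V E) (F : Set E) : V → V → Prop :=
  Relation.ReflTransGen (G.AdjOn F)

/-- `(S, F)` is a (sub)tree of `G`: `S` is nonempty, every edge of `F` has
both endpoints in `S`, the subgraph `(S, F)` is connected, and
`|F| + 1 = |S|` (for a connected subgraph this says exactly that it is
acyclic, i.e. a tree). -/
def IsTree (G : Multigraph V E) (S : Set V) (F : Set E) : Prop :=
  S.Nonempty ∧ (∀ e ∈ F, ∀ v, v ∈ G.inc e → v ∈ S) ∧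
    (∀ a ∈ S, ∀ b ∈ S, G.Reach F a b) ∧ F.ncard + 1 = S.ncard

/-- `τ(G)`: the number of spanning trees of `G` (a spanning tree is identified
with its edge set; `τ(G) = 0` when `G` is disconnected). -/
noncomputable def tau (G : Multigraph V E) : ℕ :=
  {F : Set E | G.IsTree Set.univ F}.ncard

/-- The induced subgraph `G[S]` is connected. -/
def ConnectedOn (G : Multigraph V E) (S : Set V) : Prop :=
  S.Nonempty ∧ ∀ a ∈ S, ∀ b ∈ S, G.Reach {e | ∀ w, w ∈ G.inc e → w ∈ S} a b

/-- `G` is connected. -/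
def Connected (G : Multigraph V E) : Prop :=
  G.ConnectedOn Set.univ

/-- The family `𝕊` of all sets `S` of pairs `(e, v)` with `v ≠ v_{n+1}`
(the last vertex) and `e` incident with `v`, containing exactly one pair
`(e, v)` for every vertex `v ≠ v_{n+1}`. -/
def Sys {E : Type} {n : ℕ} (G : Multigraph (Fin (n + 1)) E) :
    Set (Set (E × Fin (n + 1))) :=
  {S | (∀ p ∈ S, p.2 ≠ Fin.last n ∧ p.2 ∈ G.inc p.1) ∧
    ∀ v : Fin (n + 1), v ≠ Fin.last n → ∃! e : E, (e, v) ∈ S}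

/-- `E(S)`: the edge set of the spanning subgraph `⟨G⟩_S` determined by a
set `S` of (edge, vertex) pairs. -/
def sysEdges {E : Type} {n : ℕ} (S : Set (E × Fin (n + 1))) : Set E :=
  {e | ∃ v, (e, v) ∈ S}

/-- The vertex set of the connected component `⟨G_{v_{n+1}}⟩_S` of the
spanning subgraph `⟨G⟩_S` containing the last vertex. -/
def compVerts {E : Type} {n : ℕ} (G : Multigraph (Fin (n + 1)) E)
    (S : Set (E × Fin (n + 1))) : Set (Fin (n + 1)) :=
  {v | G.Reach (sysEdges S) (Fin.last n) v}

/-- The edge set of the connected component `⟨G_{v_{n+1}}⟩_S` of the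
spanning subgraph `⟨G⟩_S` containing the last vertex. -/
def compEdges {E : Type} {n : ℕ} (G : Multigraph (Fin (n + 1)) E)
    (S : Set (E × Fin (n + 1))) : Set E :=
  {e ∈ sysEdges S | ∃ w, w ∈ G.inc e ∧ w ∈ G.compVerts S}

/-- `NST_u(G)`: the set of non-spanning subtrees of `G` containing `u`,
each subtree given as a pair (vertex set, edge set). -/
def NST (G : Multigraph V E) (u : V) : Set (Set V × Set E) :=
  {p | G.IsTree p.1 p.2 ∧ u ∈ p.1 ∧ p.1 ≠ Set.univ}

section Reachability

variable {V E : Type} {G : Multigraph V E} {F : Set E}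

theorem AdjOn.symm {a b : V} (h : G.AdjOn F a b) : G.AdjOn F b a := by
  obtain ⟨e, he, hab⟩ := h
  exact ⟨e, he, by rw [hab, Sym2.eq_swap]⟩

theorem Reach.symm {a b : V} (h : G.Reach F a b) : G.Reach F b a := by
  induction h with
  | refl => exact Relation.ReflTransGen.refl
  | tail _ hbc ih => exact Relation.ReflTransGen.head hbc.symm ih

/-- A vertex set that is closed under `F`-adjacency is closed under `F`-reachability. -/
theorem Reach.mem_of_closed {A : Set V} (hA : ∀ a ∈ A, ∀ b, G.AdjOn F a b → b ∈ A)
    {a b : V} (ha : a ∈ A) (h : G.Reach F a b) : b ∈ A := by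
  induction h with
  | refl => exact ha
  | tail _ hbc ih => exact hA _ ih _ hbc

/-- The vertex set of a tree is determined by its edge set and any one of its vertices. -/
theorem IsTree.eq_setOf_reach {A : Set V} (h : G.IsTree A F) {u : V} (hu : u ∈ A) :
    A = {v | G.Reach F u v} := by
  refine Set.Subset.antisymm (fun v hv => h.2.2.1 u hu v hv) fun v hv => ?_
  refine Reach.mem_of_closed (fun a _ b ⟨e, he, hab⟩ => ?_) hu hv
  exact h.2.1 e he b (by simp [hab])

/-- A connected component has at most one more vertex than there are edges. -/
theorem ncard_setOf_reach_le [Finite V] [Finite E] (u : V) :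
    {v | G.Reach F u v}.ncard ≤ F.ncard + 1 := by
  let inner (A : Set V) : Set E := {e ∈ F | ∀ w ∈ G.inc e, w ∈ A}
  obtain ⟨A, ⟨huA, hcard⟩, hmax⟩ :=
    (Set.toFinite {A : Set V | u ∈ A ∧ A.ncard ≤ (inner A).ncard + 1}).exists_maximal
      ⟨{u}, by simp⟩
  have hclosed : ∀ a ∈ A, ∀ b, G.AdjOn F a b → b ∈ A := by
    rintro a ha b ⟨e, he, hab⟩
    by_contra hb
    have hnot : e ∉ inner A := fun h => hb (h.2 b (by simp [hab]))
    have hsub : insert e (inner A) ⊆ inner (insert b A) := by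
      rintro f (rfl | hf)
      · refine ⟨he, fun w hw => ?_⟩
        rw [hab, Sym2.mem_iff] at hw
        rcases hw with rfl | rfl
        · exact Set.mem_insert_of_mem _ ha
        · exact Set.mem_insert _ _
      · exact ⟨hf.1, fun w hw => Set.mem_insert_of_mem _ (hf.2 w hw)⟩
    have hle := Set.ncard_le_ncard hsub
    rw [Set.ncard_insert_of_notMem hnot] at hle
    refine hb (hmax ⟨Set.mem_insert_of_mem b huA, ?_⟩ (Set.subset_insert b A)
      (Set.mem_insert b A))
    rw [Set.ncard_insert_of_notMem hb]
    lia
  calc {v | G.Reach F u v}.ncard ≤ A.ncard :=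
        Set.ncard_le_ncard fun v hv => Reach.mem_of_closed hclosed huA hv
    _ ≤ (inner A).ncard + 1 := hcard
    _ ≤ F.ncard + 1 := by gcongr; exacts [Set.toFinite _, Set.sep_subset _ _]

end Reachability

section Component

variable {E : Type} {n : ℕ} {G : Multigraph (Fin (n + 1)) E} {S : Set (E × Fin (n + 1))}

theorem last_mem_compVerts : Fin.last n ∈ G.compVerts S := Relation.ReflTransGen.refl

theorem mem_compVerts_of_mem_compEdges {e : E} (he : e ∈ G.compEdges S) {v : Fin (n + 1)}
    (hv : v ∈ G.inc e) : v ∈ G.compVerts S := by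
  obtain ⟨heS, w, hw, hwC⟩ := he
  by_cases hvw : w = v
  · exact hvw ▸ hwC
  · exact Relation.ReflTransGen.tail hwC ⟨e, heS, (Sym2.mem_and_mem_iff hvw).1 ⟨hw, hv⟩⟩

theorem reach_compEdges_of_mem_compVerts {v : Fin (n + 1)} (hv : v ∈ G.compVerts S) :
    G.Reach (G.compEdges S) (Fin.last n) v := by
  induction hv with
  | refl => exact Relation.ReflTransGen.refl
  | @tail b c hb hbc ih =>
    obtain ⟨e, he, hbc⟩ := hbc
    exact ih.tail ⟨e, ⟨he, b, by simp [hbc], hb⟩, hbc⟩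

theorem compEdges_eq_sysEdges (h : G.compVerts S = Set.univ) :
    G.compEdges S = sysEdges S := by
  refine Set.Subset.antisymm (Set.sep_subset _ _) fun e he => ⟨he, ?_⟩
  rw [h]
  exact ⟨_, Sym2.out_fst_mem _, Set.mem_univ _⟩

/-- Each edge of the component is chosen by a vertex of the component other than the last one. -/
theorem ncard_compEdges_lt_ncard_compVerts (hS : S ∈ G.Sys) :
    (G.compEdges S).ncard + 1 ≤ (G.compVerts S).ncard := by
  have howner : ∀ e ∈ G.compEdges S, ∃ v, (e, v) ∈ S := fun e he => he.1
  choose! owner howner using howner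
  have hinj : Set.InjOn owner (G.compEdges S) := by
    intro e he f hf hef
    have hfS := howner f hf
    rw [← hef] at hfS
    exact (hS.2 _ (hS.1 _ (howner e he)).1).unique (howner e he) hfS
  have hmaps : ∀ e ∈ G.compEdges S, owner e ∈ G.compVerts S \ {Fin.last n} := fun e he =>
    ⟨mem_compVerts_of_mem_compEdges he (hS.1 _ (howner e he)).2, (hS.1 _ (howner e he)).1⟩
  have hle := Set.ncard_le_ncard_of_injOn owner hmaps hinj
  rw [← Set.ncard_sdiff_singleton_add_one (last_mem_compVerts (G := G) (S := S))]
  lia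

theorem isTree_component [Finite E] (hS : S ∈ G.Sys) :
    G.IsTree (G.compVerts S) (G.compEdges S) := by
  refine ⟨⟨_, last_mem_compVerts⟩, fun e he v => mem_compVerts_of_mem_compEdges he,
    fun a ha b hb => (reach_compEdges_of_mem_compVerts ha).symm.trans
      (reach_compEdges_of_mem_compVerts hb),
    (ncard_compEdges_lt_ncard_compVerts hS).antisymm ?_⟩
  exact (Set.ncard_le_ncard fun v => reach_compEdges_of_mem_compVerts).trans
    (ncard_setOf_reach_le _)

end Component

/-- For a loopless connected multigraph `G` with vertices `v_1, …, v_{n+1}`,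
the family `𝕊` is partitioned into the subfamily
`{S ∈ 𝕊 : E(S) = E(T) for some spanning tree T}` and the (pairwise
disjoint) subfamilies `{S ∈ 𝕊 : E(⟨G_{v_{n+1}}⟩_S) = E(T₀)}`, one for
each non-spanning subtree `T₀` of `G` containing the last vertex `v_{n+1}`:
every `S ∈ 𝕊` lies in exactly one of these subfamilies. -/
theorem sys_partition {E : Type} [Fintype E] (n : ℕ)
    (G : Multigraph (Fin (n + 1)) E) (hG : G.Connected) :
    ∀ S ∈ G.Sys,
      ((∃ F : Set E, G.IsTree Set.univ F ∧ sysEdges S = F) ∨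
          ∃ p ∈ G.NST (Fin.last n), G.compEdges S = p.2) ∧
        ¬((∃ F : Set E, G.IsTree Set.univ F ∧ sysEdges S = F) ∧
            ∃ p ∈ G.NST (Fin.last n), G.compEdges S = p.2) ∧
        ∀ p ∈ G.NST (Fin.last n), ∀ q ∈ G.NST (Fin.last n),
          G.compEdges S = p.2 → G.compEdges S = q.2 → p = q := by
  intro S hS
  have huniq : ∀ p ∈ G.NST (Fin.last n), G.compEdges S = p.2 → p.1 = G.compVerts S := by
    intro p hp hpS
    rw [hp.1.eq_setOf_reach hp.2.1, ← hpS,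
      ← (isTree_component hS).eq_setOf_reach last_mem_compVerts]
  refine ⟨?_, ?_, ?_⟩
  · have htree := isTree_component hS
    by_cases hC : G.compVerts S = Set.univ
    · rw [hC, compEdges_eq_sysEdges hC] at htree
      exact Or.inl ⟨_, htree, rfl⟩
    · exact Or.inr ⟨(G.compVerts S, G.compEdges S), ⟨htree, last_mem_compVerts, hC⟩, rfl⟩
  · rintro ⟨⟨F, hF, rfl⟩, p, hp, hpS⟩
    refine hp.2.2 ((huniq p hp hpS).trans ?_)
    exact (hF.eq_setOf_reach (Set.mem_univ (Fin.last n))).symm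
  · intro p hp q hq hpS hqS
    exact Prod.ext ((huniq p hp hpS).trans (huniq q hq hqS).symm) (hpS.symm.trans hqS)

end Multigraph
end

section
/- Let G = (V, E) be a loopless connected multigraph with V = {v_1, …, v_n}, and let 𝕊 be the family of all subsets S of {(e_j, v_i) : i ∈ [n−1], e_j ∈ E_G(v_i)} containing exactly one pair (e_j, v_i) for each i ∈ [n−1]; for S ∈ 𝕊 let ⟨G_{v_n}⟩_S be the component containing v_n of the spanning subgraph with edge set {e_j : (e_j, v_i) ∈ S}. For a non-spanning subtree T_0 of G containing v_n, let S_0(T_0) = {(e_{ψ(i)}, v_i) : v_i ∈ V(T_0) \ {v_n}}, where e_{ψ(i)} is the unique edge of E_G(v_i) on the unique path in T_0 from v_n to v_i, and let 𝕊̄(T_0) be the family of subsets S_1 of {(e_j, v_i) : v_i ∈ V \ V(T_0), e_j ∈ E_{G−V(T_0)}(v_i)} containing exactly one pair (e_j, v_i) for each v_i ∈ V \ V(T_0). Then {S ∈ 𝕊 : E(⟨G_{v_n}⟩_S) = E(T_0)} = {S_0(T_0) ∪ S_1 : S_1 ∈ 𝕊̄(T_0)}. -/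
namespace Multigraph

variable {V E : Type}

/-- `S₀(T₀)`: for a subtree `T₀ = (p.1, p.2)` of `G` containing the last
vertex `v_{n+1}`, the set of all pairs `(e, v)` with
`v ∈ V(T₀) ∖ {v_{n+1}}` and `e = e_{ψ(i)}` the unique edge of `E_G(v)`
lying on the unique path in `T₀` from `v_{n+1}` to `v` (an edge of the
tree `T₀` lies on that path iff deleting it separates `v_{n+1}` from `v`). -/
def S0 {E : Type} {n : ℕ} (G : Multigraph (Fin (n + 1)) E)
    (p : Set (Fin (n + 1)) × Set E) : Set (E × Fin (n + 1)) :=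
  {q | q.2 ∈ p.1 ∧ q.2 ≠ Fin.last n ∧ q.2 ∈ G.inc q.1 ∧
    q.1 ∈ p.2 ∧ ¬ G.Reach (p.2 \ {q.1}) (Fin.last n) q.2}

/-- `𝕊̄(T₀)`: the family of all sets `S₁` of pairs `(e, v)` with
`v ∈ V ∖ V(T₀)` and `e` an edge of `G − V(T₀)` incident with `v`,
containing exactly one pair `(e, v)` for every `v ∈ V ∖ V(T₀)`. -/
def barSys {E : Type} {n : ℕ} (G : Multigraph (Fin (n + 1)) E)
    (p : Set (Fin (n + 1)) × Set E) : Set (Set (E × Fin (n + 1))) :=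
  {S₁ | (∀ q ∈ S₁, q.2 ∉ p.1 ∧ q.2 ∈ G.inc q.1 ∧
      ∀ w, w ∈ G.inc q.1 → w ∉ p.1) ∧
    ∀ v : Fin (n + 1), v ∉ p.1 → ∃! e : E, (e, v) ∈ S₁}

theorem Reach.mono {G : Multigraph V E} {F F' : Set E} (h : F ⊆ F') {a b : V}
    (hab : G.Reach F a b) : G.Reach F' a b :=
  Relation.ReflTransGen.mono (fun _ _ ⟨e, he, hi⟩ => ⟨e, h he, hi⟩) a b hab

/-- The other endpoints of an edge with a reachable endpoint are reachable. -/
theorem Reach.of_mem_inc {G : Multigraph V E} {F : Set E} {a u w : V} {e : E}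
    (hu : G.Reach F a u) (he : e ∈ F) (hue : u ∈ G.inc e) (hwe : w ∈ G.inc e) :
    G.Reach F a w := by
  by_cases huw : u = w
  · exact huw ▸ hu
  · exact hu.tail ⟨e, he, (Sym2.mem_and_mem_iff huw).1 ⟨hue, hwe⟩⟩

/-- A connected multigraph has at most one more vertex than it has edges; here for the
component of `a` in the spanning subgraph with edge set `F`. -/
theorem ncard_reach_le [Finite V] [Finite E] (G : Multigraph V E) (F : Set E) (a : V) :
    {v | G.Reach F a v}.ncard ≤ {f ∈ F | ∃ w ∈ G.inc f, G.Reach F a w}.ncard + 1 := by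
  let inner : Set V → Set E := fun B => {f ∈ F | ∀ w ∈ G.inc f, w ∈ B}
  let good : Set (Set V) :=
    {B | B ⊆ {v | G.Reach F a v} ∧ a ∈ B ∧ B.ncard ≤ (inner B).ncard + 1}
  have hne : good.Nonempty := by
    refine ⟨{a}, ?_, rfl, by simp⟩
    rintro _ rfl
    exact Relation.ReflTransGen.refl
  obtain ⟨B, hB⟩ := (Set.toFinite good).exists_maximal hne
  obtain ⟨hBA, haB, hcard⟩ := hB.prop
  have hAB : {v | G.Reach F a v} ⊆ B := by
    intro v hv
    induction hv with
    | refl => exact haB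
    | @tail u w hau huw ih =>
      obtain ⟨f, hf, hinc⟩ := huw
      by_contra hw
      have hfB : f ∉ inner B := fun h => hw (h.2 w (by simp [hinc]))
      have hsub : insert f (inner B) ⊆ inner (insert w B) := by
        rintro g (rfl | hg)
        · refine ⟨hf, fun x hx => ?_⟩
          rw [hinc, Sym2.mem_iff] at hx
          rcases hx with rfl | rfl
          · exact Or.inr ih
          · exact Or.inl rfl
        · exact ⟨hg.1, fun x hx => Or.inr (hg.2 x hx)⟩
      have hle := Set.ncard_le_ncard hsub (Set.toFinite _)
      rw [Set.ncard_insert_of_notMem hfB (Set.toFinite _)] at hle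
      have hgood : insert w B ∈ good := by
        refine ⟨?_, Or.inr haB, ?_⟩
        · rintro x (rfl | hx)
          · exact hau.tail ⟨f, hf, hinc⟩
          · exact hBA hx
        · rw [Set.ncard_insert_of_notMem hw (Set.toFinite _)]
          omega
      exact hw (hB.le_of_ge hgood (Set.subset_insert w B) (Set.mem_insert w B))
  have hinner : inner B ⊆ {f ∈ F | ∃ w ∈ G.inc f, G.Reach F a w} := fun f hf =>
    ⟨hf.1, _, Sym2.out_fst_mem _, hBA (hf.2 _ (Sym2.out_fst_mem _))⟩
  have h1 := Set.ncard_le_ncard hAB (Set.toFinite _)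
  have h2 := Set.ncard_le_ncard hinner (Set.toFinite _)
  omega

/-- Deleting `e` either keeps `v` reachable from `a`, or leaves an endpoint of `e` reachable. -/
theorem Reach.diff_singleton_or {G : Multigraph V E} {F : Set E} {a v : V}
    (h : G.Reach F a v) (e : E) :
    G.Reach (F \ {e}) a v ∨ ∃ w ∈ G.inc e, G.Reach (F \ {e}) a w := by
  induction h with
  | refl => exact Or.inl Relation.ReflTransGen.refl
  | @tail u w _ huw ih =>
    rcases ih with ih | ih
    · obtain ⟨f, hf, hinc⟩ := huw
      by_cases hfe : f = e
      · exact Or.inr ⟨u, by simp [← hfe, hinc], ih⟩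
      · exact Or.inl (ih.tail ⟨f, ⟨hf, hfe⟩, hinc⟩)
    · exact Or.inr ih

/-- At most one edge incident with `v` separates `v` from `a`. -/
theorem eq_of_not_reach_diff {G : Multigraph V E} {F : Set E} {a v : V} {e₁ e₂ : E}
    (hv : G.Reach F a v) (he₁ : e₁ ∈ F) (hv₁ : v ∈ G.inc e₁) (hv₂ : v ∈ G.inc e₂)
    (h₁ : ¬ G.Reach (F \ {e₁}) a v) (h₂ : ¬ G.Reach (F \ {e₂}) a v) : e₁ = e₂ := by
  by_contra hne
  obtain ⟨w, hwe, hw⟩ := (hv.diff_singleton_or e₁).resolve_left h₁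
  have hw₂ : G.Reach (F \ {e₂}) a w := by
    clear hwe
    induction hw with
    | refl => exact Relation.ReflTransGen.refl
    | @tail u x hu hux ih =>
      obtain ⟨f, hf, hinc⟩ := hux
      refine ih.tail ⟨f, ⟨hf.1, fun hfe => h₁ ?_⟩, hinc⟩
      obtain rfl : f = e₂ := hfe
      exact Reach.of_mem_inc hu hf (by simp [hinc]) hv₂
  exact h₂ (hw₂.of_mem_inc ⟨he₁, hne⟩ hwe hv₁)

/-- Every edge of a tree separates one of its endpoints from a given vertex of the tree. -/
theorem IsTree.exists_not_reach_diff [Finite V] [Finite E] {G : Multigraph V E} {P : Set V}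
    {F : Set E} (hT : G.IsTree P F) {a : V} (ha : a ∈ P) {e : E} (he : e ∈ F) :
    ∃ v ∈ G.inc e, ¬ G.Reach (F \ {e}) a v := by
  by_contra! h
  obtain ⟨-, -, hconn, hcard⟩ := hT
  have hsub : P ⊆ {v | G.Reach (F \ {e}) a v} := by
    intro v hv
    have hav := hconn a ha v hv
    clear hv
    induction hav with
    | refl => exact Relation.ReflTransGen.refl
    | @tail u w _ huw ih =>
      obtain ⟨f, hf, hinc⟩ := huw
      by_cases hfe : f = e
      · exact h w (by simp [← hfe, hinc])
      · exact Relation.ReflTransGen.tail ih ⟨f, ⟨hf, hfe⟩, hinc⟩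
  have h1 := Set.ncard_le_ncard hsub (Set.toFinite _)
  have h2 := G.ncard_reach_le (F \ {e}) a
  have h3 := Set.ncard_le_ncard
    (Set.sep_subset (F \ {e}) fun f => ∃ w ∈ G.inc f, G.Reach (F \ {e}) a w) (Set.toFinite _)
  have h4 := Set.ncard_sdiff_singleton_add_one he (Set.toFinite F)
  omega

/-- In a tree, every vertex other than `a` is separated from `a` by an incident edge. -/
theorem IsTree.exists_edge_not_reach_diff [Finite V] [Finite E] {G : Multigraph V E}
    {P : Set V} {F : Set E} (hT : G.IsTree P F) {a v : V} (ha : a ∈ P) (hv : v ∈ P)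
    (hva : v ≠ a) : ∃ e ∈ F, v ∈ G.inc e ∧ ¬ G.Reach (F \ {e}) a v := by
  have h : ∀ e : E, ∃ v : V, e ∈ F → v ∈ G.inc e ∧ ¬ G.Reach (F \ {e}) a v := fun e => by
    by_cases he : e ∈ F
    · obtain ⟨v, hv⟩ := hT.exists_not_reach_diff ha he
      exact ⟨v, fun _ => hv⟩
    · exact ⟨a, fun h => absurd h he⟩
  choose φ hφ using h
  have hmem : ∀ e ∈ F, φ e ∈ P := fun e he => hT.2.1 e he _ (hφ e he).1
  have hinj : Set.InjOn φ F := fun e he f hf hef =>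
    eq_of_not_reach_diff (hT.2.2.1 a ha _ (hmem e he)) he (hφ e he).1 (hef ▸ (hφ f hf).1)
      (hφ e he).2 (hef ▸ (hφ f hf).2)
  have hsub : φ '' F ⊆ P \ {a} := by
    rintro _ ⟨e, he, rfl⟩
    refine ⟨hmem e he, fun hea => (hφ e he).2 ?_⟩
    rw [Set.mem_singleton_iff.1 hea]
    exact Relation.ReflTransGen.refl
  have himg := hinj.ncard_image
  have hcard := Set.ncard_sdiff_singleton_add_one ha (Set.toFinite P)
  have htree := hT.2.2.2
  have heq := Set.eq_of_subset_of_ncard_le hsub (by omega) (Set.toFinite _)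
  obtain ⟨e, he, rfl⟩ : v ∈ φ '' F := heq ▸ ⟨hv, hva⟩
  exact ⟨e, he, hφ e he⟩

section

variable {n : ℕ} {G : Multigraph (Fin (n + 1)) E} {p : Set (Fin (n + 1)) × Set E}
  {S : Set (E × Fin (n + 1))}

theorem eq_of_mem_S0 (hT : G.IsTree p.1 p.2) (hlast : Fin.last n ∈ p.1) {e f : E}
    {v : Fin (n + 1)} (he : (e, v) ∈ G.S0 p) (hf : (f, v) ∈ G.S0 p) : e = f :=
  eq_of_not_reach_diff (hT.2.2.1 _ hlast _ he.1) he.2.2.2.1 he.2.2.1 hf.2.2.1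
    he.2.2.2.2 hf.2.2.2.2

theorem sysEdges_S0 [Finite E] (hT : G.IsTree p.1 p.2) (hlast : Fin.last n ∈ p.1) :
    sysEdges (G.S0 p) = p.2 := by
  ext e
  refine ⟨fun ⟨v, hv⟩ => hv.2.2.2.1, fun he => ?_⟩
  obtain ⟨v, hve, hv⟩ := hT.exists_not_reach_diff hlast he
  refine ⟨v, hT.2.1 e he v hve, ?_, hve, he, hv⟩
  rintro rfl
  exact hv Relation.ReflTransGen.refl

/-- If the edges of `S` meeting a tree at the last vertex are exactly the tree edges, then the
tree spans the component of the last vertex. -/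
theorem compVerts_eq (hT : G.IsTree p.1 p.2) (hlast : Fin.last n ∈ p.1)
    (hsub : p.2 ⊆ sysEdges S)
    (hmeet : ∀ e ∈ sysEdges S, ∀ w ∈ G.inc e, w ∈ p.1 → w ∈ G.compVerts S → e ∈ p.2) :
    G.compVerts S = p.1 := by
  refine Set.Subset.antisymm (fun v hv => ?_)
    fun v hv => (hT.2.2.1 _ hlast v hv).mono hsub
  induction hv with
  | refl => exact hlast
  | @tail u w hu huw ih =>
    obtain ⟨e, he, hinc⟩ := huw
    exact hT.2.1 e (hmeet e he u (by simp [hinc]) ih hu) w (by simp [hinc])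

/-- An edge assigned by `S` to a vertex of the tree component separates that vertex from the
last one: otherwise the part of the tree still reachable would have too few edges. -/
theorem not_reach_diff_of_mem_Sys [Finite E] (hS : S ∈ G.Sys) {F : Set E}
    (hF : F ⊆ sysEdges S) {e : E} {v : Fin (n + 1)} (hev : (e, v) ∈ S) :
    ¬ G.Reach (F \ {e}) (Fin.last n) v := by
  intro hreach
  set A := {u | G.Reach (F \ {e}) (Fin.last n) u}
  set D := {f ∈ F \ {e} | ∃ w ∈ G.inc f, G.Reach (F \ {e}) (Fin.last n) w}
  have hle : A.ncard ≤ D.ncard + 1 := G.ncard_reach_le _ _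
  have hex : ∀ f ∈ D, ∃ u, (f, u) ∈ S := fun f hf => hF hf.1.1
  choose! ψ hψ using hex
  have huniq : ∀ {f g : E} {u : Fin (n + 1)}, (f, u) ∈ S → (g, u) ∈ S → f = g :=
    fun hf hg => (hS.2 _ (hS.1 _ hf).1).unique hf hg
  have hmaps : ∀ f ∈ D, ψ f ∈ (A \ {Fin.last n}) \ {v} := by
    intro f hf
    obtain ⟨hne, hinc⟩ := hS.1 _ (hψ f hf)
    obtain ⟨hfF, w, hwf, hw⟩ := hf
    refine ⟨⟨hw.of_mem_inc hfF hwf hinc, hne⟩, fun hfv => hfF.2 ?_⟩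
    have := hψ f ⟨hfF, w, hwf, hw⟩
    rw [Set.mem_singleton_iff.1 hfv] at this
    exact huniq this hev
  have hinj : Set.InjOn ψ D := fun f hf g hg hfg => huniq (hψ f hf) (hfg ▸ hψ g hg)
  have h1 := Set.ncard_le_ncard_of_injOn ψ hmaps hinj (Set.toFinite _)
  have h2 := Set.ncard_sdiff_singleton_add_one (s := A) (a := Fin.last n)
    Relation.ReflTransGen.refl (Set.toFinite _)
  have h3 := Set.ncard_sdiff_singleton_add_one (s := A \ {Fin.last n}) (a := v)
    ⟨hreach, (hS.1 _ hev).1⟩ (Set.toFinite _)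
  omega

theorem exists_barSys_of_compEdges_eq [Finite E] (hT : G.IsTree p.1 p.2)
    (hlast : Fin.last n ∈ p.1) (hS : S ∈ G.Sys) (hcomp : G.compEdges S = p.2) :
    ∃ S₁ ∈ G.barSys p, G.S0 p ∪ S₁ = S := by
  have hsub : p.2 ⊆ sysEdges S := hcomp ▸ Set.sep_subset _ _
  have hverts : G.compVerts S = p.1 := compVerts_eq hT hlast hsub
    fun e he w hwe _ hw => hcomp ▸ ⟨he, w, hwe, hw⟩
  have hedge : ∀ {e : E} {v w : Fin (n + 1)}, (e, v) ∈ S → w ∈ G.inc e → w ∈ p.1 → e ∈ p.2 :=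
    fun hev hwe hw => hcomp ▸ ⟨⟨_, hev⟩, _, hwe, hverts.symm ▸ hw⟩
  have hS0 : ∀ {e : E} {v : Fin (n + 1)}, (e, v) ∈ S → v ∈ p.1 → (e, v) ∈ G.S0 p :=
    fun hev hv => ⟨hv, (hS.1 _ hev).1, (hS.1 _ hev).2, hedge hev (hS.1 _ hev).2 hv,
      not_reach_diff_of_mem_Sys hS hsub hev⟩
  refine ⟨{q ∈ S | q.2 ∉ p.1}, ⟨?_, ?_⟩, ?_⟩
  · rintro ⟨e, v⟩ ⟨hev, hv⟩
    exact ⟨hv, (hS.1 _ hev).2, fun w hwe hw =>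
      hv (hT.2.1 e (hedge hev hwe hw) v (hS.1 _ hev).2)⟩
  · intro v hv
    obtain ⟨e, he, huniq⟩ := hS.2 v fun h => hv (h ▸ hlast)
    exact ⟨e, ⟨he, hv⟩, fun f hf => huniq f hf.1⟩
  · ext ⟨e, v⟩
    constructor
    · rintro (h | h)
      · obtain ⟨f, hf, -⟩ := hS.2 v h.2.1
        exact eq_of_mem_S0 hT hlast (hS0 hf h.1) h ▸ hf
      · exact h.1
    · intro h
      by_cases hv : v ∈ p.1
      · exact Or.inl (hS0 h hv)
      · exact Or.inr ⟨h, hv⟩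

theorem S0_union_mem_Sys [Finite E] (hT : G.IsTree p.1 p.2) (hlast : Fin.last n ∈ p.1)
    (hS : S ∈ G.barSys p) : G.S0 p ∪ S ∈ G.Sys := by
  refine ⟨?_, fun v hv => ?_⟩
  · rintro q (hq | hq)
    · exact ⟨hq.2.1, hq.2.2.1⟩
    · exact ⟨fun h => (hS.1 q hq).1 (h ▸ hlast), (hS.1 q hq).2.1⟩
  · by_cases hvp : v ∈ p.1
    · obtain ⟨e, he, hve, hreach⟩ := hT.exists_edge_not_reach_diff hlast hvp hv
      have hmem : (e, v) ∈ G.S0 p := ⟨hvp, hv, hve, he, hreach⟩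
      refine ⟨e, Or.inl hmem, ?_⟩
      rintro f (hf | hf)
      · exact eq_of_mem_S0 hT hlast hf hmem
      · exact absurd hvp (hS.1 _ hf).1
    · obtain ⟨e, he, huniq⟩ := hS.2 v hvp
      refine ⟨e, Or.inr he, ?_⟩
      rintro f (hf | hf)
      · exact absurd hf.1 hvp
      · exact huniq f hf

theorem compEdges_S0_union [Finite E] (hT : G.IsTree p.1 p.2) (hlast : Fin.last n ∈ p.1)
    (hS : S ∈ G.barSys p) : G.compEdges (G.S0 p ∪ S) = p.2 := by
  have hsub : p.2 ⊆ sysEdges (G.S0 p ∪ S) := fun e he => by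
    rw [← sysEdges_S0 hT hlast] at he
    obtain ⟨v, hv⟩ := he
    exact ⟨v, Or.inl hv⟩
  have hmeet : ∀ e ∈ sysEdges (G.S0 p ∪ S), ∀ w ∈ G.inc e, w ∈ p.1 → e ∈ p.2 := by
    rintro e ⟨v, hv | hv⟩ w hwe hw
    · exact hv.2.2.2.1
    · exact absurd hw ((hS.1 _ hv).2.2 w hwe)
  have hverts : G.compVerts (G.S0 p ∪ S) = p.1 :=
    compVerts_eq hT hlast hsub fun e he w hwe hw _ => hmeet e he w hwe hw
  ext e
  refine ⟨fun ⟨he, w, hwe, hw⟩ => hmeet e he w hwe (hverts ▸ hw), fun he => ?_⟩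
  exact ⟨hsub he, _, Sym2.out_fst_mem _, hverts.symm ▸ hT.2.1 e he _ (Sym2.out_fst_mem _)⟩

end

/-- For a loopless connected multigraph `G` with vertices `v_1, …, v_{n+1}`
and any non-spanning subtree `T₀` of `G` containing the last vertex
`v_{n+1}`, one has
`{S ∈ 𝕊 : E(⟨G_{v_{n+1}}⟩_S) = E(T₀)} = {S₀(T₀) ∪ S₁ : S₁ ∈ 𝕊̄(T₀)}`. -/
theorem sys_class_eq_union {E : Type} [Fintype E] (n : ℕ)
    (G : Multigraph (Fin (n + 1)) E) (hG : G.Connected) :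
    ∀ p ∈ G.NST (Fin.last n),
      {S | S ∈ G.Sys ∧ G.compEdges S = p.2} =
        (fun S₁ => G.S0 p ∪ S₁) '' G.barSys p := by
  rintro p ⟨hT, hlast, -⟩
  ext S
  constructor
  · rintro ⟨hS, hcomp⟩
    exact exists_barSys_of_compEdges_eq hT hlast hS hcomp
  · rintro ⟨S₁, hS₁, rfl⟩
    exact ⟨S0_union_mem_Sys hT hlast hS₁, compEdges_S0_union hT hlast hS₁⟩

end Multigraph
end
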